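/- Every mb*-probability function P taking only the values 0 and 1 is an mb*-valuation; that is, if P is an mb*-probability function with P(φ) ∈ {0,1} for all formulas φ, then P satisfies: P(α∨β)=1 iff P(α)=1 or P(β)=1; P(α∧β)=1 iff P(α)=1 and P(β)=1; P(α→β)=1 iff P(α)=0 or P(β)=1; if P(α)=1 then P(¬α)=0; and if P(α)=0 and P(¬α)=0 then P(★α)=1. -/

import Mathlib

/-- Formulas of the logic mb*, built from countably many propositional
variables via ∧ (`conj`), ∨ (`disj`), → (`impl`), ¬ (`neg`) and ★ (`star`). -/
inductive MbF : Type
  | var : ℕ → MbF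
  | conj : MbF → MbF → MbF
  | disj : MbF → MbF → MbF
  | impl : MbF → MbF → MbF
  | neg : MbF → MbF
  | star : MbF → MbF

/-- Axiom schemas of the Hilbert-style presentation of mb*. -/
inductive MbAxiom : MbF → Prop
  | ax1 (α β : MbF) : MbAxiom (.impl α (.impl β α))
  | ax2 (α β γ : MbF) :
      MbAxiom (.impl (.impl α β) (.impl (.impl α (.impl β γ)) (.impl α γ)))
  | ax3 (α β : MbF) : MbAxiom (.impl α (.impl β (.conj α β)))
  | ax4 (α β : MbF) : MbAxiom (.impl (.conj α β) α)
  | ax5 (α β : MbF) : MbAxiom (.impl (.conj α β) β)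
  | ax6 (α β : MbF) : MbAxiom (.impl α (.disj α β))
  | ax7 (α β : MbF) : MbAxiom (.impl β (.disj α β))
  | ax8 (α β γ : MbF) :
      MbAxiom (.impl (.impl α γ) (.impl (.impl β γ) (.impl (.disj α β) γ)))
  | ax9 (α β : MbF) : MbAxiom (.disj α (.impl α β))
  | ax10 (α β : MbF) : MbAxiom (.impl α (.impl (.neg α) β))
  | ax11 (α : MbF) : MbAxiom (.disj α (.disj (.neg α) (.star α)))

/-- Derivability in mb*: `MbDeriv Γ φ` means Γ ⊢ φ, i.e. φ has a derivation
from Γ using axiom instances, members of Γ, and modus ponens. -/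
inductive MbDeriv (Γ : Set MbF) : MbF → Prop
  | ax {φ : MbF} : MbAxiom φ → MbDeriv Γ φ
  | hyp {φ : MbF} : φ ∈ Γ → MbDeriv Γ φ
  | mp {φ ψ : MbF} : MbDeriv Γ (.impl φ ψ) → MbDeriv Γ φ → MbDeriv Γ ψ

/-- An mb*-valuation: a two-valued map satisfying the semantic clauses of mb*. -/
def IsMbVal (v : MbF → Fin 2) : Prop :=
  (∀ α β : MbF, v (.disj α β) = 1 ↔ v α = 1 ∨ v β = 1) ∧
  (∀ α β : MbF, v (.conj α β) = 1 ↔ v α = 1 ∧ v β = 1) ∧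
  (∀ α β : MbF, v (.impl α β) = 1 ↔ v α = 0 ∨ v β = 1) ∧
  (∀ α : MbF, v α = 1 → v (.neg α) = 0) ∧
  (∀ α : MbF, v α = 0 → v (.neg α) = 0 → v (.star α) = 1)

/-- An mb*-probability function: a `[0,1]`-valued function on formulas
satisfying tautologicity, antitautologicity, comparison and finite additivity. -/
def IsMbProb (P : MbF → ℝ) : Prop :=
  (∀ φ : MbF, P φ ∈ Set.Icc (0 : ℝ) 1) ∧
  (∀ φ : MbF, MbDeriv ∅ φ → P φ = 1) ∧
  (∀ φ : MbF, (∀ ψ : MbF, MbDeriv {φ} ψ) → P φ = 0) ∧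
  (∀ φ ψ : MbF, MbDeriv {ψ} φ → P ψ ≤ P φ) ∧
  (∀ φ ψ : MbF, P (.disj φ ψ) = P φ + P ψ - P (.conj φ ψ))

/-- Every two-valued mb*-probability function is an mb*-valuation. -/
theorem mb_two_valued_prob_is_valuation (P : MbF → ℝ) (hP : IsMbProb P)
    (h01 : ∀ φ : MbF, P φ = 0 ∨ P φ = 1) :
    (∀ α β : MbF, P (.disj α β) = 1 ↔ P α = 1 ∨ P β = 1) ∧
    (∀ α β : MbF, P (.conj α β) = 1 ↔ P α = 1 ∧ P β = 1) ∧
    (∀ α β : MbF, P (.impl α β) = 1 ↔ P α = 0 ∨ P β = 1) ∧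
    (∀ α : MbF, P α = 1 → P (.neg α) = 0) ∧
    (∀ α : MbF, P α = 0 → P (.neg α) = 0 → P (.star α) = 1) := by
  obtain ⟨hI, hT, hA, hC, hF⟩ := hP
  have cl (α β : MbF) : P (.conj α β) ≤ P α :=
    hC _ _ (.mp (.ax (.ax4 α β)) (.hyp rfl))
  have cr (α β : MbF) : P (.conj α β) ≤ P β :=
    hC _ _ (.mp (.ax (.ax5 α β)) (.hyp rfl))
  have dl (α β : MbF) : P α ≤ P (.disj α β) :=
    hC _ _ (.mp (.ax (.ax6 α β)) (.hyp rfl))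
  have dr (α β : MbF) : P β ≤ P (.disj α β) :=
    hC _ _ (.mp (.ax (.ax7 α β)) (.hyp rfl))
  have ib (α β : MbF) : P β ≤ P (.impl α β) :=
    hC _ _ (.mp (.ax (.ax1 β α)) (.hyp rfl))
  have mpc (α β : MbF) : P (.conj α (.impl α β)) ≤ P β :=
    hC _ _ (.mp (.mp (.ax (.ax5 α (.impl α β))) (.hyp rfl))
      (.mp (.ax (.ax4 α (.impl α β))) (.hyp rfl)))
  have ex (α : MbF) : P (.conj α (.neg α)) = 0 :=
    hA _ fun ψ => .mp (.mp (.ax (.ax10 α ψ)) (.mp (.ax (.ax4 α (.neg α))) (.hyp rfl)))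
      (.mp (.ax (.ax5 α (.neg α))) (.hyp rfl))
  have a9 (α β : MbF) : P (.disj α (.impl α β)) = 1 := hT _ (.ax (.ax9 α β))
  have a11 (α : MbF) : P (.disj α (.disj (.neg α) (.star α))) = 1 := hT _ (.ax (.ax11 α))
  have h0 (φ : MbF) : 0 ≤ P φ := (hI φ).1
  have h1 (φ : MbF) : P φ ≤ 1 := (hI φ).2
  refine ⟨fun α β => ⟨fun h => ?_, fun h => ?_⟩, fun α β => ⟨fun h => ⟨?_, ?_⟩, fun h => ?_⟩,
    fun α β => ⟨fun h => ?_, fun h => ?_⟩, fun α h => ?_, fun α h h' => ?_⟩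
  · rcases h01 α with ha | ha
    · right
      linarith [hF α β, h0 (.conj α β), h1 β]
    · exact Or.inl ha
  · rcases h with h | h
    · linarith [dl α β, h1 (.disj α β)]
    · linarith [dr α β, h1 (.disj α β)]
  · linarith [cl α β, h1 α]
  · linarith [cr α β, h1 β]
  · linarith [hF α β, h1 (.conj α β), h1 (.disj α β)]
  · rcases h01 α with ha | ha
    · exact Or.inl ha
    · right
      linarith [hF α (.impl α β), a9 α β, mpc α β, h1 β]
  · rcases h with h | h
    · linarith [hF α (.impl α β), a9 α β, h0 (.conj α (.impl α β)), h1 (.impl α β)]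
    · linarith [ib α β, h1 (.impl α β)]
  · linarith [hF α (.neg α), ex α, h1 (.disj α (.neg α)), h0 (.neg α)]
  · linarith [hF α (.disj (.neg α) (.star α)), a11 α, hF (.neg α) (.star α),
      h0 (.conj α (.disj (.neg α) (.star α))), h0 (.conj (.neg α) (.star α)), h1 (.star α)]
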